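/- arXiv:2102.08529 — 11 statements merged into one kernel-verified Lean document; each statement's English description precedes it below -/
import Mathlib

section
/- (Lemma 4.2) Let G' be obtained from G by inserting the edge (a,b), and let r be a landmark. A vertex v is affected (i.e., P_G(v,r) ≠ P_{G'}(v,r)) if and only if there exists a shortest path between v and r in G' that passes through the edge (a,b). -/
open SimpleGraph

/-- `shortestPathsIn G H u v` is the set of walks of the ambient graph `H` from `u` to `v`
that are shortest paths of the (sub)graph `G`: paths that use only edges of `G` and
whose length equals the distance `d_G(u, v)`.  When `G ≤ H`, shortest paths of `G`
between `u` and `v` correspond exactly (via the natural embedding) to such walks,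
so for `G ≤ G'` the set `P_G(u,v)` is `shortestPathsIn G G' u v` and
`P_{G'}(u,v)` is `shortestPathsIn G' G' u v`. -/
def shortestPathsIn {V : Type*} (G H : SimpleGraph V) (u v : V) :
    Set (H.Walk u v) :=
  {p | p.IsPath ∧ (p.length : ℕ∞) = G.edist u v ∧ ∀ e ∈ p.edges, e ∈ G.edgeSet}

/-- **Lemma 4.2.** Let `G'` be obtained from `G` by inserting the edge
`(a, b)` and let `r` be a landmark.  A vertex `v` is affected
(i.e. `P_G(v,r) ≠ P_{G'}(v,r)`) if and only if there exists a shortest path between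
`v` and `r` in `G'` that passes through the edge `(a, b)`. -/
theorem affected_iff_shortest_path_through_inserted_edge {V : Type*}
    (G G' : SimpleGraph V) (a b : V)
    (hab : a ≠ b) (hnE : ¬ G.Adj a b)
    (hG' : ∀ x y : V, G'.Adj x y ↔ G.Adj x y ∨ (x = a ∧ y = b) ∨ (x = b ∧ y = a))
    (r v : V) :
    shortestPathsIn G G' v r ≠ shortestPathsIn G' G' v r ↔
      ∃ p ∈ shortestPathsIn G' G' v r, s(a, b) ∈ p.edges := by
  constructor
  · intro hne
    by_contra hno
    push Not at hno
    apply hne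
    by_cases hr : G'.Reachable v r
    · have hle : G ≤ G' := fun x y h => (hG' x y).2 (Or.inl h)
      have hedge : ∀ p ∈ shortestPathsIn G' G' v r, ∀ e ∈ p.edges, e ∈ G.edgeSet := by
        intro p hp e he
        have h1 := hp.2.2 e he
        have h2 := hno p hp
        induction e using Sym2.ind with
        | _ x y =>
          rw [SimpleGraph.mem_edgeSet] at h1 ⊢
          rcases (hG' x y).1 h1 with h | ⟨rfl, rfl⟩ | ⟨rfl, rfl⟩
          · exact h
          · exact absurd he h2
          · exact absurd (Sym2.eq_swap ▸ he) h2
      obtain ⟨q, hqp, hq⟩ := hr.exists_path_of_dist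
      have hqm : q ∈ shortestPathsIn G' G' v r := by
        refine ⟨hqp, ?_, fun e he => q.edges_subset_edgeSet he⟩
        rw [hq, hr.coe_dist_eq_edist]
      have heq : G.edist v r = G'.edist v r := by
        apply le_antisymm
        · rw [← hqm.2.1]
          have := (q.transfer G (hedge q hqm)).edist_le
          rwa [SimpleGraph.Walk.length_transfer] at this
        · exact SimpleGraph.edist_anti hle
      ext p
      constructor
      · rintro ⟨h1, h2, h3⟩
        exact ⟨h1, heq ▸ h2, fun e he => p.edges_subset_edgeSet he⟩
      · intro hp
        exact ⟨hp.1, heq ▸ hp.2.1, hedge p hp⟩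
    · ext p
      exact absurd ⟨p⟩ hr
  · rintro ⟨p, hp, he⟩ heq
    rw [← heq] at hp
    exact hnE (hp.2.2 _ he)
end

section
/- Let G' be obtained from G by inserting the edge (a,b), and let r be a landmark with d_G(r,a) = d_G(r,b). Then no vertex is affected with respect to r, i.e., Λ_r = ∅; equivalently, for every vertex v, no shortest path between v and r in G' passes through the edge (a,b), and P_G(v,r) = P_{G'}(v,r) for all v. -/
open SimpleGraph

theorem walk_bound_aux {V : Type*} (G G' : SimpleGraph V) (a b : V)
    (hnE : ¬ G.Adj a b)
    (hG' : ∀ x y : V, G'.Adj x y ↔ G.Adj x y ∨ (x = a ∧ y = b) ∨ (x = b ∧ y = a))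
    (r : V) (heq : G.edist r a = G.edist r b) (v : V) (p : G'.Walk v r) :
    G.edist v r ≤ p.length ∧ (s(a, b) ∈ p.edges → G.edist v r + 1 ≤ p.length) := by
  induction p with
  | nil => simp
  | @cons v w r h p ih =>
    obtain ⟨ih1, ih2⟩ := ih heq
    rw [Walk.length_cons, Walk.edges_cons, List.mem_cons]
    push_cast
    rcases (hG' v w).1 h with hG | hE
    · have h1 : G.edist v r ≤ G.edist w r + 1 := by
        have := G.edist_triangle (u := v) (v := w) (w := r)
        rwa [edist_eq_one_iff_adj.2 hG, add_comm] at this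
      refine ⟨h1.trans (by gcongr), ?_⟩
      rintro (he | he)
      · exfalso
        apply hnE
        rw [← mem_edgeSet, he]
        exact hG
      · exact (add_le_add_left h1 1).trans (add_le_add_left (ih2 he) 1)
    · have h1 : G.edist v r = G.edist w r := by
        rw [G.edist_comm (u := v), G.edist_comm (u := w)]
        rcases hE with ⟨rfl, rfl⟩ | ⟨rfl, rfl⟩
        · exact heq
        · exact heq.symm
      rw [h1]
      exact ⟨ih1.trans le_self_add, fun _ => add_le_add_left ih1 1⟩

/-- Let `G'` be obtained from `G` by inserting the edge `(a, b)`,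
and let `r` be a landmark with `d_G(r, a) = d_G(r, b)`.  Then no vertex is affected
with respect to `r`: for every vertex `v`, no shortest path between `v` and `r` in
`G'` passes through the edge `(a, b)`, and `P_G(v, r) = P_{G'}(v, r)` for all `v`. -/
theorem no_affected_of_equidistant {V : Type*} (G G' : SimpleGraph V) (a b : V)
    (hab : a ≠ b) (hnE : ¬ G.Adj a b)
    (hG' : ∀ x y : V, G'.Adj x y ↔ G.Adj x y ∨ (x = a ∧ y = b) ∨ (x = b ∧ y = a))
    (r : V) (heq : G.edist r a = G.edist r b) :
    (∀ v : V, ∀ p ∈ shortestPathsIn G' G' v r, s(a, b) ∉ p.edges) ∧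
      (∀ v : V, shortestPathsIn G G' v r = shortestPathsIn G' G' v r) := by
  have hle : G ≤ G' := fun x y h => (hG' x y).2 (Or.inl h)
  have key := walk_bound_aux G G' a b hnE hG' r heq
  have hd : ∀ v, G'.edist v r = G.edist v r := by
    intro v
    apply le_antisymm (edist_anti hle)
    by_cases ht : G'.edist v r = ⊤
    · rw [ht]; exact le_top
    · obtain ⟨p, hp⟩ := exists_walk_of_edist_ne_top ht
      rw [← hp]
      exact (key v p).1
  have h1 : ∀ v : V, ∀ p ∈ shortestPathsIn G' G' v r, s(a, b) ∉ p.edges := by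
    rintro v p ⟨-, hl, -⟩ he
    have h2 := (key v p).2 he
    rw [← hd, ← hl] at h2
    norm_cast at h2
    omega
  refine ⟨h1, fun v => Set.ext fun p => ⟨?_, ?_⟩⟩
  · rintro ⟨hp, hl, -⟩
    exact ⟨hp, by rw [hd]; exact hl, fun e he => p.edges_subset_edgeSet he⟩
  · intro h
    have hn := h1 v p h
    obtain ⟨hp, hl, -⟩ := h
    refine ⟨hp, by rw [← hd]; exact hl, fun e he => ?_⟩
    have hm := p.edges_subset_edgeSet he
    induction e with
    | h x y =>
      rcases (hG' x y).1 hm with hG | ⟨rfl, rfl⟩ | ⟨rfl, rfl⟩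
      · exact hG
      · exact absurd he hn
      · exact absurd (Sym2.eq_swap ▸ he) hn
end

section
/- (Lemma 4.3) Let G' be obtained from G by inserting the edge (a,b), and let r be a landmark with d_G(r,b) > d_G(r,a). Then every affected vertex v ∈ Λ_r satisfies d_G(v,r) ≥ d_G(a,r) + 1. -/
open SimpleGraph

/-- A walk of `G'` ending at `r` uses only edges of `G`, or is longer than `d_G(a, r)`. -/
theorem walk_dichotomy_aux {V : Type*} (G G' : SimpleGraph V) (a b : V)
    (hG' : ∀ x y : V, G'.Adj x y ↔ G.Adj x y ∨ (x = a ∧ y = b) ∨ (x = b ∧ y = a))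
    (r : V) (hlt : G.edist r a < G.edist r b) (v : V) (p : G'.Walk v r) :
    (∀ e ∈ p.edges, e ∈ G.edgeSet) ∨ G.edist a r + 1 ≤ (p.length : ℕ∞) := by
  induction p with
  | nil => left; simp
  | @cons x y r h p ih =>
    rcases ih hlt with ih | ih
    · have hle : G.edist y r ≤ (p.length : ℕ∞) := by
        have := G.edist_le (p.transfer G ih)
        simpa using this
      rcases (hG' x y).1 h with h1 | ⟨rfl, rfl⟩ | ⟨rfl, rfl⟩
      · left
        intro e he
        rw [Walk.edges_cons, List.mem_cons] at he
        rcases he with rfl | he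
        · exact h1
        · exact ih e he
      · right
        rw [Walk.length_cons, Nat.cast_add, Nat.cast_one]
        rw [G.edist_comm (u := r), G.edist_comm (u := r)] at hlt
        exact add_le_add_left (hlt.le.trans hle) 1
      · right
        rw [Walk.length_cons, Nat.cast_add, Nat.cast_one]
        exact add_le_add_left hle 1
    · right
      refine ih.trans ?_
      rw [Walk.length_cons]
      exact_mod_cast Nat.le_succ _

/-- **Lemma 4.3.** Let `G'` be obtained from `G` by inserting the edge
`(a, b)`, and let `r` be a landmark with `d_G(r, b) > d_G(r, a)`.  Then every
affected vertex `v ∈ Λ_r` (i.e. with `P_G(v,r) ≠ P_{G'}(v,r)`) satisfies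
`d_G(v, r) ≥ d_G(a, r) + 1`. -/
theorem affected_edist_ge {V : Type*} (G G' : SimpleGraph V) (a b : V)
    (hab : a ≠ b) (hnE : ¬ G.Adj a b)
    (hG' : ∀ x y : V, G'.Adj x y ↔ G.Adj x y ∨ (x = a ∧ y = b) ∨ (x = b ∧ y = a))
    (r : V) (hlt : G.edist r a < G.edist r b) :
    ∀ v : V, shortestPathsIn G G' v r ≠ shortestPathsIn G' G' v r →
      G.edist a r + 1 ≤ G.edist v r := by
  intro v hne
  by_contra hcon
  rw [not_le] at hcon
  apply hne
  have hle : G ≤ G' := fun x y h => (hG' x y).2 (Or.inl h)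
  have key : ∀ p : G'.Walk v r, (p.length : ℕ∞) ≤ G.edist v r →
      ∀ e ∈ p.edges, e ∈ G.edgeSet := by
    intro p hp
    rcases walk_dichotomy_aux G G' a b hG' r hlt v p with h | h
    · exact h
    · exact absurd (h.trans hp) (not_le.2 hcon)
  have hanti : G'.edist v r ≤ G.edist v r := edist_anti hle
  have heq : G.edist v r = G'.edist v r := by
    apply le_antisymm _ hanti
    have hfin : G'.edist v r ≠ ⊤ := (hanti.trans_lt (hcon.trans_le le_top)).ne
    obtain ⟨p, hp⟩ := exists_walk_of_edist_ne_top hfin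
    rw [← hp]
    have := G.edist_le (p.transfer G (key p (hp.le.trans hanti)))
    simpa using this
  ext p
  constructor
  · rintro ⟨h1, h2, h3⟩
    exact ⟨h1, h2.trans heq, fun e he => p.edges_subset_edgeSet he⟩
  · rintro ⟨h1, h2, h3⟩
    exact ⟨h1, h2.trans heq.symm, key p (h2.trans heq.symm).le⟩
end

section
/- Let G' be obtained from G by inserting the edge (a,b), and let r be a landmark with d_G(r,b) > d_G(r,a). Then the vertex a is unaffected with respect to r: no shortest path between a and r in G' passes through the edge (a,b), P_G(a,r) = P_{G'}(a,r), and in particular d_{G'}(r,a) = d_G(r,a). -/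
open SimpleGraph

/-- Potential-function lower bound on the length of walks in the augmented graph. -/
theorem potential_le_length {V : Type*} (G G' : SimpleGraph V) (a b : V)
    (hG' : ∀ x y : V, G'.Adj x y ↔ G.Adj x y ∨ (x = a ∧ y = b) ∨ (x = b ∧ y = a))
    (r : V) (hlt : G.edist a r < G.edist b r) {u : V} (p : G'.Walk u r) :
    min (G.edist u r) (G.edist u b + (G.edist a r + 1)) ≤ (p.length : ℕ∞) := by
  have hle : G.edist a r + 1 ≤ G.edist b r := Order.add_one_le_of_lt hlt
  induction p with
  | nil => simp
  | @cons u v w h p ih =>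
    specialize ih hlt hle
    have hl : ((Walk.cons h p).length : ℕ∞) = p.length + 1 := by simp
    rw [hl]
    refine le_trans ?_ (add_le_add_left ih 1)
    rcases (hG' u v).1 h with h | ⟨rfl, rfl⟩ | ⟨rfl, rfl⟩
    · have key : ∀ x, G.edist u x ≤ G.edist v x + 1 := fun x => by
        have := G.edist_triangle (u := u) (v := v) (w := x)
        rwa [edist_eq_one_iff_adj.2 h, add_comm] at this
      rw [min_add]
      refine min_le_min (key w) ?_
      calc _ ≤ (G.edist v b + 1) + (G.edist a w + 1) := add_le_add_left (key b) _
        _ = _ := by ring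
    · refine (min_le_left _ _).trans ?_
      refine le_trans ?_ (le_self_add)
      refine le_min hlt.le ?_
      exact le_self_add.trans le_add_self
    · refine (min_le_right _ _).trans ?_
      rw [edist_self, zero_add]
      gcongr
      refine le_min le_rfl ?_
      exact le_self_add.trans le_add_self

/-- Let `G'` be obtained from `G` by inserting the edge `(a, b)`,
and let `r` be a landmark with `d_G(r, b) > d_G(r, a)`.  Then the vertex `a` is
unaffected with respect to `r`: no shortest path between `a` and `r` in `G'` passes
through the edge `(a, b)`, `P_G(a, r) = P_{G'}(a, r)`, and in particular
`d_{G'}(r, a) = d_G(r, a)`. -/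
theorem endpoint_unaffected {V : Type*} (G G' : SimpleGraph V) (a b : V)
    (hab : a ≠ b) (hnE : ¬ G.Adj a b)
    (hG' : ∀ x y : V, G'.Adj x y ↔ G.Adj x y ∨ (x = a ∧ y = b) ∨ (x = b ∧ y = a))
    (r : V) (hlt : G.edist r a < G.edist r b) :
    (∀ p ∈ shortestPathsIn G' G' a r, s(a, b) ∉ p.edges) ∧
      shortestPathsIn G G' a r = shortestPathsIn G' G' a r ∧
      G'.edist r a = G.edist r a := by
  classical
  have hlt' : G.edist a r < G.edist b r := by
    rwa [G.edist_comm (u := a), G.edist_comm (u := b)]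
  have hle : G ≤ G' := fun x y h => (hG' x y).2 (Or.inl h)
  have hA : ∀ p : G'.Walk a r, G.edist a r ≤ p.length := fun p => by
    refine le_trans (le_min le_rfl ?_) (potential_le_length G G' a b hG' r hlt' p)
    exact le_self_add.trans le_add_self
  have hB : ∀ p : G'.Walk b r, G.edist a r + 1 ≤ p.length := fun p => by
    refine le_trans (le_min (Order.add_one_le_of_lt hlt') ?_)
      (potential_le_length G G' a b hG' r hlt' p)
    exact le_add_self
  have hd : G'.edist a r = G.edist a r :=
    le_antisymm (edist_anti hle) (le_iInf hA)
  have h1 : ∀ p ∈ shortestPathsIn G' G' a r, s(a, b) ∉ p.edges := by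
    rintro p ⟨-, hlen, -⟩ he
    have hb : b ∈ p.support := p.snd_mem_support_of_mem_edges he
    have h2 := hB (p.dropUntil b hb)
    have h3 : ((p.dropUntil b hb).length : ℕ∞) ≤ p.length := by
      exact_mod_cast p.length_dropUntil_le hb
    have h4 := h2.trans h3
    rw [hlen, hd] at h4
    exact absurd h4 (not_le.2 (ENat.lt_add_one_iff hlt'.ne_top |>.2 le_rfl))
  refine ⟨h1, ?_, by rw [G'.edist_comm, hd, G.edist_comm]⟩
  ext p
  constructor
  · rintro ⟨hp, hl, -⟩
    exact ⟨hp, hl.trans hd.symm, fun e he => p.edges_subset_edgeSet he⟩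
  · intro hp
    refine ⟨hp.1, hp.2.1.trans hd, fun e he => ?_⟩
    have hne := h1 p hp
    have hE := p.edges_subset_edgeSet he
    induction e using Sym2.ind with
    | _ x y =>
      rcases (hG' x y).1 hE with h | ⟨rfl, rfl⟩ | ⟨rfl, rfl⟩
      · exact h
      · exact absurd he hne
      · rw [Sym2.eq_swap] at he
        exact absurd he hne
end

section
/- Let G' be obtained from G by inserting the edge (a,b), and let r be a landmark with d_G(r,b) > d_G(r,a). Then every affected vertex v ∈ Λ_r satisfies d_{G'}(r,v) = d_G(r,a) + 1 + d_{G'}(b,v) (arithmetic in ℕ∞). -/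
open SimpleGraph

lemma walk_in_or_long {V : Type*} (G G' : SimpleGraph V) (a b : V)
    (hab : a ≠ b)
    (hG' : ∀ x y : V, G'.Adj x y ↔ G.Adj x y ∨ (x = a ∧ y = b) ∨ (x = b ∧ y = a))
    (r : V) (hlt : G.edist r a < G.edist r b) {x z : V} (p : G'.Walk x z) (hz : z = r) :
    (∀ e ∈ p.edges, e ∈ G.edgeSet) ∨ G.edist r a + 1 + G'.edist b x ≤ (p.length : ℕ∞) := by
  have hba : G'.edist b a = 1 := by
    rw [edist_eq_one_iff_adj, hG']; simp
  induction p with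
  | nil => left; simp
  | @cons u y w h q ih =>
    subst hz
    have ih := ih rfl
    have hlen : (∀ e ∈ q.edges, e ∈ G.edgeSet) → G.edist w y ≤ (q.length : ℕ∞) := by
      intro hq
      have := edist_le (q.transfer G hq)
      rwa [Walk.length_transfer, SimpleGraph.edist_comm] at this
    simp only [Walk.length_cons, Nat.cast_add, Nat.cast_one]
    rcases (hG' u y).1 h with h1 | ⟨rfl, rfl⟩ | ⟨rfl, rfl⟩
    · rcases ih with ih | ih
      · left
        intro e he
        rw [Walk.edges_cons, List.mem_cons] at he
        rcases he with rfl | he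
        · exact h1
        · exact ih e he
      · right
        have ht : G'.edist b u ≤ G'.edist b y + 1 := by
          have := G'.edist_triangle (u := b) (v := y) (w := u)
          rwa [edist_eq_one_iff_adj.2 h.symm] at this
        calc _ ≤ G.edist w a + 1 + (G'.edist b y + 1) := by gcongr
          _ = G.edist w a + 1 + G'.edist b y + 1 := by ring
          _ ≤ _ := by gcongr
    · right
      rw [hba]
      gcongr
      rcases ih with ih | ih
      · exact (Order.add_one_le_of_lt hlt).trans (hlen ih)
      · exact le_self_add.trans ih
    · right
      rw [edist_self, add_zero]
      gcongr
      rcases ih with ih | ih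
      · exact hlen ih
      · exact le_self_add.trans (le_self_add.trans ih)

/-- Let `G'` be obtained from `G` by inserting the edge `(a, b)`,
and let `r` be a landmark with `d_G(r, b) > d_G(r, a)`.  Then every affected vertex
`v ∈ Λ_r` satisfies `d_{G'}(r, v) = d_G(r, a) + 1 + d_{G'}(b, v)`
(arithmetic in `ℕ∞`). -/
theorem affected_new_edist {V : Type*} (G G' : SimpleGraph V) (a b : V)
    (hab : a ≠ b) (hnE : ¬ G.Adj a b)
    (hG' : ∀ x y : V, G'.Adj x y ↔ G.Adj x y ∨ (x = a ∧ y = b) ∨ (x = b ∧ y = a))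
    (r : V) (hlt : G.edist r a < G.edist r b) :
    ∀ v : V, shortestPathsIn G G' v r ≠ shortestPathsIn G' G' v r →
      G'.edist r v = G.edist r a + 1 + G'.edist b v := by
  intro v hne
  have hle : G ≤ G' := fun x y h => (hG' x y).2 (Or.inl h)
  have hE : G'.edist a b = 1 := by
    rw [edist_eq_one_iff_adj, hG']; simp
  have hup : G'.edist r v ≤ G.edist r a + 1 + G'.edist b v := by
    calc G'.edist r v ≤ G'.edist r b + G'.edist b v := G'.edist_triangle
      _ ≤ G'.edist r a + G'.edist a b + G'.edist b v := by
        gcongr; exact G'.edist_triangle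
      _ ≤ _ := by
        rw [hE]; gcongr
  by_contra hcon
  have hl : G'.edist v r < G.edist r a + 1 + G'.edist b v := by
    rw [SimpleGraph.edist_comm]; exact lt_of_le_of_ne hup hcon
  have key : ∀ p : G'.Walk v r, (p.length : ℕ∞) = G'.edist v r →
      ∀ e ∈ p.edges, e ∈ G.edgeSet := by
    intro p hp
    rcases walk_in_or_long G G' a b hab hG' r hlt p rfl with h | h
    · exact h
    · rw [hp] at h; exact absurd h (not_le.2 hl)
  obtain ⟨p, hp⟩ := exists_walk_of_edist_ne_top (ne_top_of_lt hl)
  have heq : G.edist v r = G'.edist v r := by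
    apply le_antisymm _ (edist_anti hle)
    have := edist_le (p.transfer G (key p hp))
    rwa [Walk.length_transfer, hp] at this
  apply hne
  ext q
  simp only [shortestPathsIn, Set.mem_setOf_eq, heq]
  constructor
  · rintro ⟨h1, h2, _⟩
    exact ⟨h1, h2, fun e he => q.edges_subset_edgeSet he⟩
  · rintro ⟨h1, h2, _⟩
    exact ⟨h1, h2, key q h2⟩
end

section
/- Let G' be obtained from G by inserting the edge (a,b), and let r be a landmark with d_G(r,b) > d_G(r,a). Then every affected vertex v ∈ Λ_r with v ≠ b has a neighbor w in G' such that w is also affected (w ∈ Λ_r) and d_{G'}(r,w) + 1 = d_{G'}(r,v). (This justifies that a breadth-first search started from b reaches all affected vertices by moving only through affected vertices.) -/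
open SimpleGraph

/-- Let `G'` be obtained from `G` by inserting the edge `(a, b)`,
and let `r` be a landmark with `d_G(r, b) > d_G(r, a)`.  Then every affected vertex
`v ∈ Λ_r` with `v ≠ b` has a neighbour `w` in `G'` such that `w` is also affected
and `d_{G'}(r, w) + 1 = d_{G'}(r, v)`.  (This justifies that a BFS started from `b`
reaches all affected vertices by moving only through affected vertices.) -/
theorem affected_has_affected_parent {V : Type*} (G G' : SimpleGraph V) (a b : V)
    (hab : a ≠ b) (hnE : ¬ G.Adj a b)
    (hG' : ∀ x y : V, G'.Adj x y ↔ G.Adj x y ∨ (x = a ∧ y = b) ∨ (x = b ∧ y = a))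
    (r : V) (hlt : G.edist r a < G.edist r b) :
    ∀ v : V, shortestPathsIn G G' v r ≠ shortestPathsIn G' G' v r → v ≠ b →
      ∃ w : V, G'.Adj v w ∧
        shortestPathsIn G G' w r ≠ shortestPathsIn G' G' w r ∧
        G'.edist r w + 1 = G'.edist r v := by
  classical
  intro v hv hvb
  have hle : G ≤ G' := fun x y h => (hG' x y).2 (Or.inl h)
  -- a shortest path of `G'` that uses an edge outside `G`
  obtain ⟨p, hp, hlen, e, he, heG⟩ : ∃ p : G'.Walk v r, p.IsPath ∧
      (p.length : ℕ∞) = G'.edist v r ∧ ∃ e ∈ p.edges, e ∉ G.edgeSet := by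
    by_contra hcon
    push Not at hcon
    apply hv
    have key : ∀ p : G'.Walk v r, (p.length : ℕ∞) = G'.edist v r →
        G.edist v r = G'.edist v r := by
      intro p hl
      have hp : p.IsPath := by
        apply p.isPath_of_length_eq_dist
        rw [SimpleGraph.dist, ← hl]; rfl
      apply le_antisymm _ (edist_anti hle)
      rw [← hl, ← p.length_transfer (hcon p hp hl)]
      exact edist_le _
    ext p
    constructor
    · rintro ⟨h1, h2, h3⟩
      have hr : G'.Reachable v r := ⟨p⟩
      obtain ⟨q, hq⟩ := hr.exists_walk_length_eq_edist
      exact ⟨h1, h2.trans (key q hq), fun e he => p.edges_subset_edgeSet he⟩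
    · rintro ⟨h1, h2, h3⟩
      exact ⟨h1, h2.trans (key p h2).symm, hcon p h1 h2⟩
  cases p with
  | nil => simp at he
  | @cons _ w _ h q =>
    have hq : q.IsPath := hp.of_cons
    have htri : G'.edist v r ≤ G'.edist w r + 1 := by
      calc G'.edist v r ≤ G'.edist v w + G'.edist w r := SimpleGraph.edist_triangle
        _ = G'.edist w r + 1 := by rw [edist_eq_one_iff_adj.2 h, add_comm]
    have hqlen : (q.length : ℕ∞) = G'.edist w r := by
      apply le_antisymm _ (edist_le q)
      rw [← hlen, Walk.length_cons] at htri
      push_cast at htri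
      exact (ENat.add_le_add_iff_right (by simp)).1 htri
    have hstep : G'.edist w r + 1 = G'.edist v r := by
      rw [← hqlen, ← hlen, Walk.length_cons]; push_cast; rfl
    refine ⟨w, h, ?_, by rw [edist_comm, hstep, edist_comm]⟩
    intro heq
    have hmem : q ∈ shortestPathsIn G' G' w r :=
      ⟨hq, hqlen, fun e he => q.edges_subset_edgeSet he⟩
    rw [← heq] at hmem
    obtain ⟨-, h2, h3⟩ := hmem
    rw [Walk.edges_cons, List.mem_cons] at he
    rcases he with rfl | he
    · rcases (hG' v w).1 h with h' | ⟨rfl, rfl⟩ | ⟨h', -⟩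
      · exact heG h'
      · have h4 : G'.edist v r ≤ G.edist v r := edist_anti hle
        rw [← hstep, ← hqlen, h2] at h4
        rw [edist_comm, edist_comm (u := r)] at hlt
        exact absurd (le_self_add.trans h4) (not_le.2 hlt)
      · exact hvb h'
    · exact heG (h3 e he)
end

section
/- Let G' be obtained from G by inserting the edge (a,b), and let r be a landmark with d_G(r,b) > d_G(r,a). Then a vertex v is affected (v ∈ Λ_r) if and only if d_{G'}(b,v) < ∞ and d_G(r,v) ≥ d_G(r,a) + 1 + d_{G'}(b,v) (arithmetic and comparison in ℕ∞). (This justifies the pruning condition used when searching for affected vertices.) -/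
open SimpleGraph

theorem edist_le_of_edges_mem {V : Type*} {G G' : SimpleGraph V} {u v : V} (p : G'.Walk u v)
    (h : ∀ e ∈ p.edges, e ∈ G.edgeSet) : G.edist u v ≤ p.length := by
  have := G.edist_le (p.transfer G h)
  simpa using this

theorem walk_dichotomy {V : Type*} (G G' : SimpleGraph V) (a b : V)
    (hG' : ∀ x y : V, G'.Adj x y ↔ G.Adj x y ∨ (x = a ∧ y = b) ∨ (x = b ∧ y = a))
    (r : V) (hlt : G.edist r a < G.edist r b) {v : V} (p : G'.Walk v r) :
    (∀ e ∈ p.edges, e ∈ G.edgeSet) ∨ G.edist r a + 1 + G'.edist b v ≤ p.length := by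
  induction p with
  | nil => left; simp
  | @cons x y z h p ih =>
    rcases ih hlt with ih | ih
    · have h2 := edist_le_of_edges_mem p ih
      rw [edist_comm] at h2
      rcases (hG' x y).1 h with h1 | ⟨rfl, rfl⟩ | ⟨rfl, rfl⟩
      · left
        intro e he
        simp only [Walk.edges_cons, List.mem_cons] at he
        rcases he with rfl | he
        · exact h1
        · exact ih e he
      · right
        rw [edist_eq_one_iff_adj.2 h.symm]
        have h3 : G.edist z x + 1 ≤ p.length := (Order.add_one_le_of_lt hlt).trans h2
        push_cast [Walk.length_cons]
        gcongr
      · right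
        simp only [edist_self, Walk.length_cons, add_zero]
        push_cast
        gcongr
    · right
      have h1 : G'.edist b x ≤ G'.edist b y + 1 := by
        refine G'.edist_triangle.trans (add_le_add_right (edist_eq_one_iff_adj.2 h.symm).le _)
      calc G.edist z a + 1 + G'.edist b x ≤ G.edist z a + 1 + (G'.edist b y + 1) := by gcongr
        _ = (G.edist z a + 1 + G'.edist b y) + 1 := by ring
        _ ≤ p.length + 1 := by gcongr
        _ = _ := by simp

theorem isPath_of_length_eq_edist {V : Type*} {G : SimpleGraph V} {u v : V} (p : G.Walk u v)
    (h : (p.length : ℕ∞) = G.edist u v) : p.IsPath := by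
  apply p.isPath_of_length_eq_dist
  have := (Walk.reachable p).coe_dist_eq_edist
  rw [← h] at this
  exact_mod_cast this.symm

/-- Let `G'` be obtained from `G` by inserting the edge `(a, b)`,
and let `r` be a landmark with `d_G(r, b) > d_G(r, a)`.  Then a vertex `v` is
affected (`v ∈ Λ_r`) if and only if `d_{G'}(b, v) < ∞` and
`d_G(r, v) ≥ d_G(r, a) + 1 + d_{G'}(b, v)` (arithmetic and comparison in `ℕ∞`).
(This justifies the pruning condition used when searching for affected vertices.) -/
theorem affected_iff_pruning_condition {V : Type*} (G G' : SimpleGraph V) (a b : V)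
    (hab : a ≠ b) (hnE : ¬ G.Adj a b)
    (hG' : ∀ x y : V, G'.Adj x y ↔ G.Adj x y ∨ (x = a ∧ y = b) ∨ (x = b ∧ y = a))
    (r : V) (hlt : G.edist r a < G.edist r b) :
    ∀ v : V, shortestPathsIn G G' v r ≠ shortestPathsIn G' G' v r ↔
      G'.edist b v < ⊤ ∧ G.edist r a + 1 + G'.edist b v ≤ G.edist r v := by
  intro v
  have hle : G ≤ G' := fun x y h => (hG' x y).2 (Or.inl h)
  have hanti : G'.edist v r ≤ G.edist v r := edist_anti hle
  have hadj : G'.Adj b a := (hG' b a).2 (Or.inr (Or.inr ⟨rfl, rfl⟩))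
  constructor
  · intro hne
    by_contra hc
    apply hne
    have key : ∀ p : G'.Walk v r, (p.length : ℕ∞) ≤ G.edist v r →
        ∀ e ∈ p.edges, e ∈ G.edgeSet := by
      intro p hp
      rcases walk_dichotomy G G' a b hG' r hlt p with h | h
      · exact h
      · exfalso
        apply hc
        refine ⟨?_, ?_⟩
        · exact (le_add_self.trans h).trans_lt (ENat.natCast_lt_top _)
        · rw [G.edist_comm (u := r) (v := v)]
          exact h.trans hp
    have heq : G.edist v r = G'.edist v r := by
      apply le_antisymm _ hanti
      by_cases ht : G'.edist v r = ⊤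
      · simp [ht]
      · obtain ⟨p, hp⟩ := exists_walk_of_edist_ne_top ht
        rw [← hp]
        exact edist_le_of_edges_mem p (key p (hp ▸ hanti))
    ext p
    constructor
    · rintro ⟨h1, h2, h3⟩
      exact ⟨h1, h2.trans heq, fun e he => p.edges_subset_edgeSet he⟩
    · rintro ⟨h1, h2, h3⟩
      exact ⟨h1, h2.trans heq.symm, key p (h2.trans heq.symm).le⟩
  · rintro ⟨hfin, hc⟩ heq
    obtain ⟨p, hp⟩ := exists_walk_of_edist_ne_top hfin.ne
    obtain ⟨q, hq⟩ := exists_walk_of_edist_ne_top (ne_top_of_lt hlt)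
    let w : G'.Walk v r := p.reverse.append (Walk.cons hadj (q.mapLe hle).reverse)
    have hw : (w.length : ℕ∞) = G.edist r a + 1 + G'.edist b v := by
      rw [← hp, ← hq]
      simp [w]
      ring
    have hwle := G'.edist_le w
    obtain ⟨s, hs⟩ := exists_walk_of_edist_ne_top
      (ne_top_of_le_ne_top (ENat.natCast_ne_top _) hwle)
    have hmem : s ∈ shortestPathsIn G' G' v r :=
      ⟨isPath_of_length_eq_edist s hs, hs, fun e he => s.edges_subset_edgeSet he⟩
    rw [← heq] at hmem
    have hsG := hmem.2.1
    have hwe : (w.length : ℕ∞) = G'.edist v r := by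
      apply le_antisymm _ hwle
      rw [← hs, hsG, hw, G.edist_comm (u := v) (v := r)]
      exact hc
    have hwm : w ∈ shortestPathsIn G' G' v r :=
      ⟨isPath_of_length_eq_edist w hwe, hwe, fun e he => w.edges_subset_edgeSet he⟩
    rw [← heq] at hwm
    have this : G.Adj b a := hwm.2.2 s(b, a) (by simp [w])
    exact hnE (this.symm)
end

section
/- (Correctness of highway-cover distance queries) Suppose the distance labelling L satisfies the highway cover property over G with landmark set R. Then for any two vertices u,v ∈ V∖R: min( d_{G[V∖R]}(u,v), inf { d_G(u,r_i) + d_G(r_i,r_j) + d_G(r_j,v) : r_i ∈ L(u), r_j ∈ L(v) } ) = d_G(u,v), where G[V∖R] is the subgraph of G induced on V∖R and the minimum and infimum are taken in ℕ∞. -/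
open SimpleGraph

/-- A finite infimum in the highway cover property is attained. -/
theorem highway_cover_attained {V : Type*} (S : Set V) (f : V → ℕ∞) (a : ℕ∞) (ha : a ≠ ⊤)
    (h : a = ⨅ x ∈ S, f x) : ∃ x ∈ S, f x ≤ a := by
  have h1 : (⨅ x ∈ S, f x) < a + 1 := by
    rw [← h]
    exact (ENat.lt_add_one_iff ha).2 le_rfl
  obtain ⟨x, hx⟩ := iInf_lt_iff.1 h1
  obtain ⟨hxS, hx⟩ := iInf_lt_iff.1 hx
  exact ⟨x, hxS, (ENat.lt_add_one_iff ha).1 hx⟩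

/-- **correctness of highway-cover distance queries.**
Suppose the distance labelling `L` (assigning to each vertex a set of landmarks
`L v ⊆ R`) satisfies the highway cover property over `G` with landmark set `R`:
for every `v ∉ R` and every `r ∈ R`,
`d_G(r, v) = inf { d_G(rᵢ, v) + d_G(r, rᵢ) : rᵢ ∈ L v }`.
Then for any two vertices `u, v ∉ R`,
`min (d_{G[V∖R]}(u, v)) (inf { d_G(u, rᵢ) + d_G(rᵢ, rⱼ) + d_G(rⱼ, v) : rᵢ ∈ L u, rⱼ ∈ L v })
  = d_G(u, v)`,
where `G[V∖R]` is the subgraph of `G` induced on `V∖R` and the minimum and infimum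
are taken in `ℕ∞`. -/
theorem highway_cover_query_correct {V : Type*} (G : SimpleGraph V)
    (R : Set V) (L : V → Set V) (hL : ∀ v : V, L v ⊆ R)
    (hHC : ∀ v ∉ R, ∀ r ∈ R,
      G.edist r v = ⨅ ri ∈ L v, (G.edist ri v + G.edist r ri))
    (u v : V) (hu : u ∉ R) (hv : v ∉ R) :
    min ((G.induce Rᶜ).edist ⟨u, hu⟩ ⟨v, hv⟩)
      (⨅ ri ∈ L u, ⨅ rj ∈ L v, (G.edist u ri + G.edist ri rj + G.edist rj v))
      = G.edist u v := by
  classical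
  apply le_antisymm
  · by_cases htop : G.edist u v = ⊤
    · rw [htop]; exact le_top
    obtain ⟨p, hp⟩ := G.exists_walk_of_edist_ne_top htop
    by_cases hs : ∀ x ∈ p.support, x ∈ Rᶜ
    · refine (min_le_left _ _).trans ?_
      have h2 : (p.induce Rᶜ hs).length = p.length := by
        conv_rhs => rw [← Walk.map_induce p hs]
        exact (Walk.length_map _ _).symm
      rw [← hp, ← h2]
      exact edist_le _
    · push Not at hs
      obtain ⟨r, hr, hrR⟩ := hs
      have hrR : r ∈ R := by simpa using hrR
      refine (min_le_right _ _).trans ?_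
      have h1 : G.edist r u ≤ (p.takeUntil r hr).length := by
        rw [edist_comm]; exact edist_le _
      have h2 : G.edist r v ≤ (p.dropUntil r hr).length := edist_le _
      have h3 : ((p.takeUntil r hr).length : ℕ∞) + (p.dropUntil r hr).length = p.length := by
        conv_rhs => rw [← p.take_spec hr, Walk.length_append]
        push_cast
        rfl
      obtain ⟨ri, hri, hi⟩ := highway_cover_attained _ _ _
        (ne_top_of_le_ne_top (ENat.coe_ne_top _) h1) (hHC u hu r hrR)
      obtain ⟨rj, hrj, hj⟩ := highway_cover_attained _ _ _
        (ne_top_of_le_ne_top (ENat.coe_ne_top _) h2) (hHC v hv r hrR)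
      refine (iInf₂_le ri hri).trans ((iInf₂_le rj hrj).trans ?_)
      calc G.edist u ri + G.edist ri rj + G.edist rj v
          ≤ G.edist u ri + (G.edist ri r + G.edist r rj) + G.edist rj v := by
            gcongr
            exact G.edist_triangle
        _ = (G.edist ri u + G.edist r ri) + (G.edist rj v + G.edist r rj) := by
            rw [G.edist_comm (u := u), G.edist_comm (u := ri) (v := r)]
            ring
        _ ≤ G.edist r u + G.edist r v := add_le_add hi hj
        _ ≤ _ := add_le_add h1 h2
        _ = _ := by rw [h3, hp]
  · refine le_min ?_ ?_
    · refine le_iInf fun w => ?_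
      have := edist_le (w.map (Embedding.induce Rᶜ).toHom)
      rw [Walk.length_map] at this
      exact this
    · refine le_iInf₂ fun ri _ => le_iInf₂ fun rj _ => ?_
      exact G.edist_triangle.trans (add_le_add_left G.edist_triangle _)
end

section
/- Suppose the distance labelling L satisfies the highway cover property over G with landmark set R, and let u,v ∈ V∖R. If some shortest path between u and v in G contains a landmark of R, then the upper bound d⊤_{uv} := inf { d_G(u,r_i) + d_G(r_i,r_j) + d_G(r_j,v) : r_i ∈ L(u), r_j ∈ L(v) } satisfies d⊤_{uv} = d_G(u,v); in general d⊤_{uv} ≥ d_G(u,v). -/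
open SimpleGraph

/-- `shortestPaths G u v` is the set of shortest paths between `u` and `v` in `G`:
paths whose length equals the distance `d_G(u, v)`. -/
def shortestPaths {V : Type*} (G : SimpleGraph V) (u v : V) : Set (G.Walk u v) :=
  {p | p.IsPath ∧ (p.length : ℕ∞) = G.edist u v}

/-- Suppose the distance labelling `L` satisfies the highway cover
property over `G` with landmark set `R`, and let `u, v ∉ R`.  Then the upper bound
`d⊤_{uv} := inf { d_G(u, rᵢ) + d_G(rᵢ, rⱼ) + d_G(rⱼ, v) : rᵢ ∈ L u, rⱼ ∈ L v }`
always satisfies `d⊤_{uv} ≥ d_G(u, v)`, and if some shortest path between `u` and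
`v` in `G` contains a landmark of `R`, then `d⊤_{uv} = d_G(u, v)`. -/
theorem upper_bound_correct {V : Type*} (G : SimpleGraph V)
    (R : Set V) (L : V → Set V) (hL : ∀ v : V, L v ⊆ R)
    (hHC : ∀ v ∉ R, ∀ r ∈ R,
      G.edist r v = ⨅ ri ∈ L v, (G.edist ri v + G.edist r ri))
    (u v : V) (hu : u ∉ R) (hv : v ∉ R) :
    G.edist u v ≤
        (⨅ ri ∈ L u, ⨅ rj ∈ L v, (G.edist u ri + G.edist ri rj + G.edist rj v)) ∧
      ((∃ p ∈ shortestPaths G u v, ∃ r ∈ R, r ∈ p.support) →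
        (⨅ ri ∈ L u, ⨅ rj ∈ L v, (G.edist u ri + G.edist ri rj + G.edist rj v))
          = G.edist u v) := by
  have hle : G.edist u v ≤
      (⨅ ri ∈ L u, ⨅ rj ∈ L v, (G.edist u ri + G.edist ri rj + G.edist rj v)) := by
    refine le_iInf₂ fun a _ => le_iInf₂ fun b _ => ?_
    exact G.edist_triangle.trans (add_le_add_left G.edist_triangle _)
  refine ⟨hle, ?_⟩
  rintro ⟨p, ⟨-, hp⟩, r, hr, hrp⟩
  refine le_antisymm ?_ hle
  classical
  have hlen : (p.takeUntil r hrp).length + (p.dropUntil r hrp).length = p.length := by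
    rw [← Walk.length_append, Walk.take_spec]
  have h1 : G.edist r u ≤ ((p.takeUntil r hrp).length : ℕ∞) := by
    rw [G.edist_comm]; exact Walk.edist_le _
  have h2 : G.edist r v ≤ ((p.dropUntil r hrp).length : ℕ∞) := Walk.edist_le _
  have key : ∀ w ∉ R, ∀ n : ℕ, G.edist r w ≤ n →
      ∃ a ∈ L w, G.edist a w + G.edist r a ≤ n := by
    intro w hw n hn
    have h : (⨅ ri ∈ L w, (G.edist ri w + G.edist r ri)) < (n : ℕ∞) + 1 := by
      rw [← hHC w hw r hr]
      exact lt_of_le_of_lt hn (by exact_mod_cast Nat.lt_succ_self n)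
    simp only [iInf_lt_iff] at h
    obtain ⟨a, ha, h⟩ := h
    exact ⟨a, ha, Order.le_of_lt_add_one h⟩
  obtain ⟨a, ha, h1⟩ := key u hu _ h1
  obtain ⟨b, hb, h2⟩ := key v hv _ h2
  refine (iInf₂_le_of_le a ha (iInf₂_le b hb)).trans ?_
  calc G.edist u a + G.edist a b + G.edist b v
      ≤ G.edist u a + (G.edist a r + G.edist r b) + G.edist b v := by
        gcongr; exact G.edist_triangle
    _ = (G.edist a u + G.edist r a) + (G.edist b v + G.edist r b) := by
        rw [G.edist_comm (u := u) (v := a), G.edist_comm (u := a) (v := r)]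
        ac_rfl
    _ ≤ _ := add_le_add h1 h2
    _ = G.edist u v := by rw [← hp, ← hlen]; push_cast; rfl
end

section
/- (Necessity of label entries, core of labelling minimality) Suppose the distance labelling L satisfies the highway cover property over G with landmark set R. Let v ∈ V∖R and r ∈ R with d_G(r,v) < ∞. If no shortest path between r and v in G contains a landmark of R∖{r}, then r ∈ L(v). -/
open SimpleGraph

/-- **necessity of label entries, core of labelling minimality.**
Suppose the distance labelling `L` satisfies the highway cover property over `G`
with landmark set `R`.  Let `v ∉ R` and `r ∈ R` with `d_G(r, v) < ∞`.  If no
shortest path between `r` and `v` in `G` contains a landmark of `R ∖ {r}`, then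
`r ∈ L v`. -/
theorem label_entry_necessary {V : Type*} (G : SimpleGraph V)
    (R : Set V) (L : V → Set V) (hL : ∀ v : V, L v ⊆ R)
    (hHC : ∀ v ∉ R, ∀ r ∈ R,
      G.edist r v = ⨅ ri ∈ L v, (G.edist ri v + G.edist r ri))
    (v r : V) (hv : v ∉ R) (hr : r ∈ R) (hfin : G.edist r v < ⊤)
    (hno : ∀ p ∈ shortestPaths G r v, ∀ r' ∈ R, r' ≠ r → r' ∉ p.support) :
    r ∈ L v := by
  have h := hHC v hv r hr
  have hlt : (⨅ ri ∈ L v, (G.edist ri v + G.edist r ri)) < G.edist r v + 1 := by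
    rw [← h]
    exact ENat.lt_add_one_iff hfin.ne |>.2 le_rfl
  simp only [iInf_lt_iff] at hlt
  obtain ⟨s, hs, hlt⟩ := hlt
  have hle := (ENat.lt_add_one_iff hfin.ne).1 hlt
  by_cases hsr : s = r
  · exact hsr ▸ hs
  exfalso
  have hsum : G.edist s v + G.edist r s ≠ ⊤ := (hle.trans_lt hfin).ne
  have h1 : G.edist s v ≠ ⊤ := fun h => hsum (by rw [h, top_add])
  have h2 : G.edist r s ≠ ⊤ := fun h => hsum (by rw [h, add_top])
  obtain ⟨p, hp⟩ := exists_walk_of_edist_ne_top h2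
  obtain ⟨q, hq⟩ := exists_walk_of_edist_ne_top h1
  have hlen : ((p.append q).length : ℕ∞) = G.edist r v := by
    apply le_antisymm _ (edist_le _)
    rw [Walk.length_append, Nat.cast_add, hp, hq, add_comm]
    exact hle
  have hpath : (p.append q).IsPath := by
    apply Walk.isPath_of_length_eq_dist
    rw [SimpleGraph.dist, ← hlen, ENat.toNat_coe]
  refine hno _ ⟨hpath, hlen⟩ s (hL v hs) hsr ?_
  rw [Walk.mem_support_append_iff]
  exact Or.inl p.end_mem_support
end

section
/- (Sufficiency of the canonical minimal labelling) Given landmark set R ⊆ V, define the distance labelling L* by L*(v) := { r ∈ R : there exists a shortest path between r and v in G containing no landmark of R∖{r} } for each v ∈ V∖R. Then L* satisfies the highway cover property: for every vertex v ∈ V∖R and every landmark r ∈ R, d_G(r,v) = inf { d_G(r_i,v) + d_G(r,r_i) : r_i ∈ L*(v) } (infimum in ℕ∞). -/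
open SimpleGraph

/-- Every walk from a landmark to `v` dominates a route through some label of `v`. -/
theorem exists_label_of_walk {V : Type*} (G : SimpleGraph V) (R : Set V) (v : V) :
    ∀ n : ℕ, ∀ r ∈ R, ∀ p : G.Walk r v, p.length ≤ n →
      ∃ x ∈ {x ∈ R | ∃ p ∈ shortestPaths G x v, ∀ r' ∈ R, r' ≠ x → r' ∉ p.support},
        G.edist x v + G.edist r x ≤ (p.length : ℕ∞) := by
  classical
  intro n
  induction n using Nat.strong_induction_on with
  | _ n ih =>
    intro r hr p hp
    obtain ⟨q, hq⟩ := p.reachable.exists_walk_length_eq_edist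
    have hqp : (q.length : ℕ∞) ≤ p.length := hq ▸ edist_le p
    have hqp' : q.length ≤ p.length := by exact_mod_cast hqp
    by_cases h : ∀ r' ∈ R, r' ≠ r → r' ∉ q.support
    · have hle : q.bypass.length ≤ q.length := q.length_bypass_le
      refine ⟨r, ⟨hr, q.bypass, ⟨q.bypass_isPath, le_antisymm ?_ (edist_le _)⟩, ?_⟩, ?_⟩
      · rw [← hq]; exact_mod_cast hle
      · exact fun r' h1 h2 h3 => h r' h1 h2 (q.support_bypass_subset h3)
      · simpa [← hq] using hqp'
    · push Not at h
      obtain ⟨s, hs, hne, hmem⟩ := h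
      have hlen : (q.takeUntil s hmem).length + (q.dropUntil s hmem).length = q.length := by
        rw [← Walk.length_append, Walk.take_spec]
      have hpos : 0 < (q.takeUntil s hmem).length := by
        rcases Nat.eq_zero_or_pos (q.takeUntil s hmem).length with h0 | h0
        · exact absurd (Walk.eq_of_length_eq_zero h0).symm hne
        · exact h0
      obtain ⟨x, hx, hle⟩ := ih (q.dropUntil s hmem).length (by omega) s hs _ le_rfl
      refine ⟨x, hx, ?_⟩
      calc G.edist x v + G.edist r x
          ≤ G.edist x v + (G.edist r s + G.edist s x) := by
            gcongr; exact SimpleGraph.edist_triangle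
        _ = G.edist r s + (G.edist x v + G.edist s x) := by ring
        _ ≤ ((q.takeUntil s hmem).length : ℕ∞) + ((q.dropUntil s hmem).length : ℕ∞) :=
            add_le_add (edist_le _) hle
        _ = (q.length : ℕ∞) := by exact_mod_cast hlen
        _ ≤ _ := hqp

/-- **sufficiency of the canonical minimal labelling.**
Given a landmark set `R`, define the labelling
`L*(v) := { r ∈ R : some shortest path between r and v in G contains no landmark of R∖{r} }`.
Then `L*` satisfies the highway cover property: for every vertex `v ∉ R` and every
landmark `r ∈ R`,
`d_G(r, v) = inf { d_G(rᵢ, v) + d_G(r, rᵢ) : rᵢ ∈ L*(v) }` (infimum in `ℕ∞`). -/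
theorem canonical_labelling_is_highway_cover {V : Type*} (G : SimpleGraph V)
    (R : Set V) :
    ∀ v ∉ R, ∀ r ∈ R,
      G.edist r v =
        ⨅ ri ∈ {x ∈ R | ∃ p ∈ shortestPaths G x v, ∀ r' ∈ R, r' ≠ x → r' ∉ p.support},
          (G.edist ri v + G.edist r ri) := by
  intro v _ r hr
  apply le_antisymm
  · refine le_iInf₂ fun x _ => ?_
    rw [add_comm]
    exact SimpleGraph.edist_triangle
  · by_cases h : G.edist r v = ⊤
    · rw [h]; exact le_top
    · obtain ⟨p, hp⟩ := exists_walk_of_edist_ne_top h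
      obtain ⟨x, hx, hle⟩ := exists_label_of_walk G R v _ r hr p le_rfl
      exact (iInf₂_le x hx).trans (hle.trans hp.le)
end
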